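/- For all real numbers s, t > 0 with s + t = 1 and all real numbers β, c > 0, the set Bad(s,t) ⊆ ℝ² is (β,c)-hyperplane potential winning; that is, Alice has a winning strategy for the (β,c)-hyperplane potential game played on ℝ² with target set Bad(s,t). -/

import Mathlib

open Metric Filter

/-- Distance from a real number to the nearest integer. -/
noncomputable def distNearestInt (x : ℝ) : ℝ := |x - ((round x : ℤ) : ℝ)|

/-- The set `Bad(s,t) ⊆ ℝ²` of pairs `(x,y)` such that
`inf_{q ∈ ℕ⁺} max (q^s ‖qx‖) (q^t ‖qy‖) > 0`. -/
noncomputable def badPair (s t : ℝ) : Set (ℝ × ℝ) :=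
  {p | 0 < ⨅ q : ℕ+, max (((q : ℕ) : ℝ) ^ s * distNearestInt (((q : ℕ) : ℝ) * p.1))
      (((q : ℕ) : ℝ) ^ t * distNearestInt (((q : ℕ) : ℝ) * p.2))}

/-- An affine line in ℝ²: a nonempty affine subspace whose direction has dimension 1. -/
def IsLine (L : AffineSubspace ℝ (ℝ × ℝ)) : Prop :=
  (L : Set (ℝ × ℝ)).Nonempty ∧ Module.finrank ℝ L.direction = 1

/-- The closed `γ`-thickening `L^(γ) = {p : dist(p, L) ≤ γ}` of a line `L`. -/
noncomputable def lineNbhd (L : AffineSubspace ℝ (ℝ × ℝ)) (γ : ℝ) : Set (ℝ × ℝ) :=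
  {p | Metric.infDist p (L : Set (ℝ × ℝ)) ≤ γ}

/-- Alice has a winning strategy for the `(β,c)`-hyperplane potential game on ℝ² with target
set `S`.  A strategy for Alice assigns to each history of Bob's balls (represented as
(center, radius) pairs `h 0, …, h n`) a countable collection (indexed by `ℕ`) of pairs
(line `L_{i,n}`, thickening radius `r_{i,n}`); entries of radius `0` represent no chosen set,
so that finite collections are allowed.  The strategy must be legal: whenever Bob's last ball
has positive radius `rₙ`, each chosen entry with positive radius is a line, and
`Σᵢ r_{i,n}^c ≤ (β rₙ)^c` (in particular the series converges).  It is winning if for every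
sequence of moves of Bob obeying the rules (`B₀` has positive radius, `r_{n+1} ≥ β rₙ`,
`B_{n+1} ⊆ Bₙ`), either the radii do not tend to `0` (Alice wins by default), or every point
of `⋂ₙ Bₙ` (i.e. the outcome) belongs to `S` or to one of the thickened lines
`L_{i,n}^{(r_{i,n})}` chosen by Alice during the game (in which case she also wins by
default). -/
def IsHPWWin (β c : ℝ) (S : Set (ℝ × ℝ)) : Prop :=
  ∃ σ : (n : ℕ) → (Fin (n + 1) → (ℝ × ℝ) × ℝ) → ℕ → AffineSubspace ℝ (ℝ × ℝ) × ℝ,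
    (∀ (n : ℕ) (h : Fin (n + 1) → (ℝ × ℝ) × ℝ), 0 < (h (Fin.last n)).2 →
      (∀ i : ℕ, 0 ≤ (σ n h i).2 ∧ (0 < (σ n h i).2 → IsLine (σ n h i).1)) ∧
      Summable (fun i : ℕ => (σ n h i).2 ^ c) ∧
      (∑' i : ℕ, (σ n h i).2 ^ c) ≤ (β * (h (Fin.last n)).2) ^ c) ∧
    ∀ B : ℕ → (ℝ × ℝ) × ℝ, 0 < (B 0).2 →
      (∀ n : ℕ, β * (B n).2 ≤ (B (n + 1)).2 ∧
        closedBall (B (n + 1)).1 (B (n + 1)).2 ⊆ closedBall (B n).1 (B n).2) →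
      (¬ Tendsto (fun n => (B n).2) atTop (nhds 0)) ∨
        ∀ x : ℝ × ℝ, (∀ n : ℕ, x ∈ closedBall (B n).1 (B n).2) →
          (x ∈ S ∨ ∃ (n : ℕ) (i : ℕ), 0 < (σ n (fun j => B j.1) i).2 ∧
            x ∈ lineNbhd (σ n (fun j => B j.1) i).1 (σ n (fun j => B j.1) i).2)

/-- `(p/q, r/q)` is a weighted `c`-approximation of `(x, y)` of least denominator. -/
structure IsFirstApprox (s t c x y : ℝ) (q p r : ℤ) : Prop where
  pos : 0 < q
  left : (q : ℝ) ^ s * |q * x - p| < c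
  right : (q : ℝ) ^ t * |q * y - r| < c
  min : ∀ q' p' r' : ℤ, 0 < q' → q' < q →
    ¬ ((q' : ℝ) ^ s * |q' * x - p'| < c ∧ (q' : ℝ) ^ t * |q' * y - r'| < c)

/-- The line `A x + B y + C = 0` passes through `(p/q, r/q)` and has small coefficients. -/
structure IsLineThrough (s t : ℝ) (q p r A B C : ℤ) : Prop where
  eq : A * p + B * r + C * q = 0
  left : |(A : ℝ)| ≤ (q : ℝ) ^ s
  right : |(B : ℝ)| ≤ (q : ℝ) ^ t
  ne : 1 ≤ max |(A : ℝ)| |(B : ℝ)|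

section

variable {s t c x y : ℝ} {q p r A B C : ℤ}

lemma IsFirstApprox.swap (h : IsFirstApprox s t c x y q p r) :
    IsFirstApprox t s c y x q r p :=
  ⟨h.pos, h.right, h.left, fun q' p' r' h1 h2 h3 => h.min q' r' p' h1 h2 h3.symm⟩

lemma IsLineThrough.swap (h : IsLineThrough s t q p r A B C) :
    IsLineThrough t s q r p B A C :=
  ⟨by linarith [h.eq], h.right, h.left, by rw [max_comm]; exact h.ne⟩

lemma IsFirstApprox.one_le (h : IsFirstApprox s t c x y q p r) : (1 : ℝ) ≤ q := by
  exact_mod_cast h.pos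

/-- Evaluating a linear form at an approximated point. -/
lemma IsFirstApprox.abs_form_sub_le {K : ℝ} (h : IsFirstApprox s t c x y q p r)
    (hA : |(A : ℝ)| ≤ K * (q : ℝ) ^ s) (hB : |(B : ℝ)| ≤ K * (q : ℝ) ^ t) (hK : 0 ≤ K) :
    |q * (A * x + B * y + C) - (A * p + B * r + C * q)| ≤ 2 * K * c := by
  have e : (q : ℝ) * (A * x + B * y + C) - (A * p + B * r + C * q)
      = A * (q * x - p) + B * (q * y - r) := by ring
  rw [e]
  have h1 : |(A : ℝ) * (q * x - p)| ≤ K * c := by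
    rw [abs_mul]
    calc |(A : ℝ)| * |q * x - p| ≤ K * (q : ℝ) ^ s * |q * x - p| := by gcongr
      _ = K * ((q : ℝ) ^ s * |q * x - p|) := by ring
      _ ≤ K * c := by gcongr; exact h.left.le
  have h2 : |(B : ℝ) * (q * y - r)| ≤ K * c := by
    rw [abs_mul]
    calc |(B : ℝ)| * |q * y - r| ≤ K * (q : ℝ) ^ t * |q * y - r| := by gcongr
      _ = K * ((q : ℝ) ^ t * |q * y - r|) := by ring
      _ ≤ K * c := by gcongr; exact h.right.le
  linarith [abs_add_le ((A : ℝ) * (q * x - p)) (B * (q * y - r))]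

lemma IsFirstApprox.mul_abs_form_le (h : IsFirstApprox s t c x y q p r)
    (hl : IsLineThrough s t q p r A B C) :
    q * |A * x + B * y + C| ≤ 2 * c := by
  have := h.abs_form_sub_le (K := 1) (C := C) (by simpa using hl.left)
    (by simpa using hl.right) zero_le_one
  have e : (A * p + B * r + C * q : ℝ) = 0 := by exact_mod_cast hl.eq
  rw [e, sub_zero, abs_mul, abs_of_nonneg (by linarith [h.one_le])] at this
  linarith

lemma IsFirstApprox.const_pos (h : IsFirstApprox s t c x y q p r) : 0 < c := by
  have := h.one_le
  exact lt_of_le_of_lt (by positivity) h.left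

/-- The approximated points of two triples which are proportional coincide. -/
lemma IsFirstApprox.eq_of_proportional {x' y' : ℝ} {q' p' r' : ℤ} (hs : 0 < s) (ht : 0 < t)
    (h : IsFirstApprox s t c x y q p r) (h' : IsFirstApprox s t c x' y' q' p' r')
    (hp : q * p' = q' * p) (hr : q * r' = q' * r) : q = q' ∧ p = p' ∧ r = r' := by
  have key : ∀ {x y x' y' : ℝ} {q p r q' p' r' : ℤ}, IsFirstApprox s t c x y q p r →
      IsFirstApprox s t c x' y' q' p' r' → q * p' = q' * p → q * r' = q' * r → ¬ q < q' := by
    intro x y x' y' q p r q' p' r' h h' hp hr hlt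
    have h1 := h.one_le
    have hlt' : (q : ℝ) < q' := by exact_mod_cast hlt
    have hq' : (0 : ℝ) < q' := by linarith
    have aux : ∀ {z : ℝ} {a a' : ℤ} {k : ℝ}, 0 < k → q * a' = q' * a →
        (q' : ℝ) ^ k * |q' * z - a'| < c → (q : ℝ) ^ k * |q * z - a| < c := by
      intro z a a' k hk ha hz
      have ha' : (q : ℝ) * a' = q' * a := by exact_mod_cast ha
      have e : (q : ℝ) * z - a = q / q' * (q' * z - a') := by
        field_simp
        linarith
      have hle : (q : ℝ) ^ k ≤ (q' : ℝ) ^ k := by gcongr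
      have h2 : (q : ℝ) / q' ≤ 1 := by rw [div_le_one hq']; exact hlt'.le
      refine lt_of_le_of_lt ?_ hz
      rw [e, abs_mul, abs_of_nonneg (by positivity)]
      have : (q : ℝ) / q' * |q' * z - a'| ≤ 1 * |q' * z - a'| := by gcongr
      rw [one_mul] at this
      gcongr
    exact h'.min q p r h.pos hlt ⟨aux hs hp h'.left, aux ht hr h'.right⟩
  have hqq : q = q' := le_antisymm (not_lt.1 (key h' h hp.symm hr.symm)) (not_lt.1 (key h h' hp hr))
  subst hqq
  have h0 := h.pos.ne'
  exact ⟨rfl, (mul_left_cancel₀ h0 hp).symm, (mul_left_cancel₀ h0 hr).symm⟩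

end

section

variable {s t c ρ x₁ y₁ x₂ y₂ : ℝ} {q₁ p₁ r₁ A₁ B₁ C₁ q₂ p₂ r₂ A₂ B₂ C₂ : ℤ}

/-- The form attached to one point is small at a nearby point. -/
lemma mul_abs_form_le_of_near
    (h₁ : IsFirstApprox s t c x₁ y₁ q₁ p₁ r₁) (h₂ : IsFirstApprox s t c x₂ y₂ q₂ p₂ r₂)
    (l₂ : IsLineThrough s t q₂ p₂ r₂ A₂ B₂ C₂)
    (hx : |x₁ - x₂| ≤ 2 * ρ) (hy : |y₁ - y₂| ≤ 2 * ρ) (hq : (q₁ : ℝ) ≤ 4 * q₂) :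
    q₁ * |A₂ * x₁ + B₂ * y₁ + C₂|
      ≤ 8 * c + 4 * (ρ * max |(A₂ : ℝ)| |(B₂ : ℝ)| * q₁) := by
  have h := h₂.mul_abs_form_le l₂
  have hq₁ := h₁.one_le
  have e : (A₂ * x₁ + B₂ * y₁ + C₂ : ℝ)
      = (A₂ * x₂ + B₂ * y₂ + C₂) + (A₂ * (x₁ - x₂) + B₂ * (y₁ - y₂)) := by ring
  set M := max |(A₂ : ℝ)| |(B₂ : ℝ)| with hM
  have hA : |(A₂ : ℝ)| ≤ M := le_max_left _ _
  have hB : |(B₂ : ℝ)| ≤ M := le_max_right _ _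
  have hM0 : 0 ≤ M := le_trans (abs_nonneg _) hA
  have b1 : |(A₂ : ℝ) * (x₁ - x₂)| ≤ M * (2 * ρ) := by rw [abs_mul]; gcongr
  have b2 : |(B₂ : ℝ) * (y₁ - y₂)| ≤ M * (2 * ρ) := by rw [abs_mul]; gcongr
  have b3 : |(A₂ * x₁ + B₂ * y₁ + C₂ : ℝ)| ≤ |(A₂ * x₂ + B₂ * y₂ + C₂ : ℝ)| + 4 * (M * ρ) := by
    rw [e]
    linarith [abs_add_le (A₂ * x₂ + B₂ * y₂ + C₂ : ℝ) (A₂ * (x₁ - x₂) + B₂ * (y₁ - y₂)),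
      abs_add_le ((A₂ : ℝ) * (x₁ - x₂)) (B₂ * (y₁ - y₂))]
  have b4 : q₁ * |(A₂ * x₂ + B₂ * y₂ + C₂ : ℝ)| ≤ 8 * c := by
    calc q₁ * |(A₂ * x₂ + B₂ * y₂ + C₂ : ℝ)| ≤ 4 * q₂ * |(A₂ * x₂ + B₂ * y₂ + C₂ : ℝ)| := by
          gcongr
      _ ≤ 8 * c := by linarith
  calc q₁ * |(A₂ * x₁ + B₂ * y₁ + C₂ : ℝ)|
      ≤ q₁ * (|(A₂ * x₂ + B₂ * y₂ + C₂ : ℝ)| + 4 * (M * ρ)) := by gcongr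
    _ ≤ 8 * c + 4 * (ρ * M * q₁) := by linarith

lemma rpow_le_four_mul_rpow {a b k : ℝ} (ha : 0 ≤ a) (hb : 0 ≤ b) (h : a ≤ 4 * b)
    (hk : 0 < k) (hk1 : k ≤ 1) : a ^ k ≤ 4 * b ^ k := by
  calc a ^ k ≤ (4 * b) ^ k := by gcongr
    _ = 4 ^ k * b ^ k := Real.mul_rpow (by norm_num) hb
    _ ≤ 4 ^ (1 : ℝ) * b ^ k := by gcongr; norm_num
    _ = 4 * b ^ k := by rw [Real.rpow_one]

/-- If the ball is small enough, each of the two points lies on the line of the other. -/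
lemma form_eq_zero_of_near (hs : 0 < s) (ht : 0 < t) (hst : s + t = 1) (hc : c ≤ 1 / 64)
    (h₁ : IsFirstApprox s t c x₁ y₁ q₁ p₁ r₁) (h₂ : IsFirstApprox s t c x₂ y₂ q₂ p₂ r₂)
    (l₂ : IsLineThrough s t q₂ p₂ r₂ A₂ B₂ C₂)
    (hx : |x₁ - x₂| ≤ 2 * ρ) (hy : |y₁ - y₂| ≤ 2 * ρ)
    (hq : (q₁ : ℝ) ≤ 4 * q₂) (hq' : (q₂ : ℝ) ≤ 4 * q₁)
    (hρ : ρ * max |(A₂ : ℝ)| |(B₂ : ℝ)| * q₁ ≤ 1 / 8) :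
    A₂ * p₁ + B₂ * r₁ + C₂ * q₁ = 0 := by
  have n := mul_abs_form_le_of_near h₁ h₂ l₂ hx hy hq
  have hq₁ := h₁.one_le
  have hq₂ := h₂.one_le
  have hA := l₂.left.trans (rpow_le_four_mul_rpow (by linarith) (by linarith) hq' hs (by linarith))
  have hB := l₂.right.trans (rpow_le_four_mul_rpow (by linarith) (by linarith) hq' ht (by linarith))
  have m := h₁.abs_form_sub_le (C := C₂) hA hB (by norm_num)
  rw [← abs_of_nonneg (show (0 : ℝ) ≤ q₁ by linarith), ← abs_mul,
    abs_of_nonneg (show (0 : ℝ) ≤ q₁ by linarith)] at n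
  rw [abs_le] at n m
  have : |((A₂ * p₁ + B₂ * r₁ + C₂ * q₁ : ℤ) : ℝ)| < 1 := by
    push_cast
    rw [abs_lt]
    constructor <;> linarith [n.1, n.2, m.1, m.2]
  exact Int.abs_lt_one_iff.1 (by exact_mod_cast this)

set_option maxHeartbeats 1000000 in
/-- Two lines of moderate slope that come close to each other meet in a rational point of small
denominator, which contradicts minimality unless the lines coincide. -/
lemma cross_eq_zero_of_flat {u E e : ℝ} (hs : 0 < s) (ht : 0 < t) (hst : s + t = 1)
    (hc : c ≤ 1 / 64)
    (h₁ : IsFirstApprox s t c x₁ y₁ q₁ p₁ r₁) (h₂ : IsFirstApprox s t c x₂ y₂ q₂ p₂ r₂)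
    (l₁ : IsLineThrough s t q₁ p₁ r₁ A₁ B₁ C₁) (l₂ : IsLineThrough s t q₂ p₂ r₂ A₂ B₂ C₂)
    (hx : |x₁ - x₂| ≤ 2 * ρ) (hy : |y₁ - y₂| ≤ 2 * ρ)
    (hq : (q₁ : ℝ) ≤ 4 * q₂) (hq' : (q₂ : ℝ) ≤ 4 * q₁)
    (hM : max |(A₂ : ℝ)| |(B₂ : ℝ)| ≤ 8 * max |(A₁ : ℝ)| |(B₁ : ℝ)|)
    (hρ : ρ * max |(A₂ : ℝ)| |(B₂ : ℝ)| * q₁ ≤ E / 16)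
    (hu : 1 ≤ u) (hMu : max |(A₁ : ℝ)| |(B₁ : ℝ)| * u ≤ (q₁ : ℝ) ^ s)
    (hE : 1 ≤ E) (hEe : E ≤ e) (heu : e * e ≤ u ^ s) (hce : 12 < c * e) :
    A₁ * B₂ = A₂ * B₁ ∧ A₁ * C₂ = A₂ * C₁ ∧ B₁ * C₂ = B₂ * C₁ := by
  have n₂ := mul_abs_form_le_of_near h₁ h₂ l₂ hx hy hq
  have n₁ := h₁.mul_abs_form_le l₁
  have hq₁ := h₁.one_le
  have hq₂ := h₂.one_le
  have c0 := h₁.const_pos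
  have hQ : (0 : ℝ) < q₁ := by linarith
  have hB₂ := l₂.right.trans
    (rpow_le_four_mul_rpow (by linarith) (by linarith) hq' ht (by linarith))
  have hB₁ := l₁.right
  have hM1 := l₁.ne
  have hab : (q₁ : ℝ) ^ s * (q₁ : ℝ) ^ t = q₁ := by
    rw [← Real.rpow_add hQ, hst, Real.rpow_one]
  have ha1 : 1 ≤ (q₁ : ℝ) ^ s := Real.one_le_rpow hq₁ hs.le
  have hb1 : 1 ≤ (q₁ : ℝ) ^ t := Real.one_le_rpow hq₁ ht.le
  have hA₁ : |(A₁ : ℝ)| ≤ max |(A₁ : ℝ)| |(B₁ : ℝ)| := le_max_left _ _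
  have hA₂ : |(A₂ : ℝ)| ≤ 8 * max |(A₁ : ℝ)| |(B₁ : ℝ)| := (le_max_left _ _).trans hM
  set M := max |(A₁ : ℝ)| |(B₁ : ℝ)|
  set a := (q₁ : ℝ) ^ s with ha
  set b := (q₁ : ℝ) ^ t with hb
  set F₁ : ℝ := A₁ * x₁ + B₁ * y₁ + C₁ with hF₁
  set F₂ : ℝ := A₂ * x₁ + B₂ * y₁ + C₂ with hF₂
  have he1 : 1 ≤ e := hE.trans hEe
  have hus : u ^ s ≤ u := by
    calc u ^ s ≤ u ^ (1 : ℝ) := by gcongr; linarith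
      _ = u := Real.rpow_one u
  have he12 : 12 < e := by nlinarith
  have heu' : 12 * e < u := by nlinarith
  have hn₂ : q₁ * |F₂| ≤ 8 * c + E / 4 := by linarith
  have hMu' : M ≤ a / u := by rw [le_div_iff₀ (by linarith)]; exact hMu
  set q₀ : ℤ := A₁ * B₂ - A₂ * B₁ with hq₀
  set p₀ : ℤ := B₁ * C₂ - B₂ * C₁ with hp₀
  set r₀ : ℤ := A₂ * C₁ - A₁ * C₂ with hr₀
  have ep : (q₀ : ℝ) * x₁ - p₀ = B₂ * F₁ - B₁ * F₂ := by
    rw [hq₀, hp₀, hF₁, hF₂]; push_cast; ring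
  have er : (q₀ : ℝ) * y₁ - r₀ = A₁ * F₂ - A₂ * F₁ := by
    rw [hq₀, hr₀, hF₁, hF₂]; push_cast; ring
  have bq : |(q₀ : ℝ)| * u ≤ 12 * q₁ := by
    have : |(q₀ : ℝ)| ≤ M * (4 * b) + 8 * M * b := by
      rw [hq₀]; push_cast
      calc |(A₁ * B₂ - A₂ * B₁ : ℝ)| ≤ |(A₁ * B₂ : ℝ)| + |(A₂ * B₁ : ℝ)| := abs_sub _ _
        _ = |(A₁ : ℝ)| * |(B₂ : ℝ)| + |(A₂ : ℝ)| * |(B₁ : ℝ)| := by rw [abs_mul, abs_mul]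
        _ ≤ _ := by gcongr
    calc |(q₀ : ℝ)| * u ≤ (M * (4 * b) + 8 * M * b) * u := by gcongr
      _ = 12 * (M * u) * b := by ring
      _ ≤ 12 * a * b := by gcongr
      _ = 12 * q₁ := by rw [mul_assoc, hab]
  have bp : a * |(q₀ : ℝ) * x₁ - p₀| ≤ E / 2 := by
    have h1 : q₁ * |(q₀ : ℝ) * x₁ - p₀| ≤ b * (E / 2) := by
      rw [ep]
      calc q₁ * |(B₂ * F₁ - B₁ * F₂ : ℝ)| ≤ q₁ * (|(B₂ * F₁ : ℝ)| + |(B₁ * F₂ : ℝ)|) := by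
            gcongr; exact abs_sub _ _
        _ = |(B₂ : ℝ)| * (q₁ * |F₁|) + |(B₁ : ℝ)| * (q₁ * |F₂|) := by
            rw [abs_mul, abs_mul]; ring
        _ ≤ 4 * b * (2 * c) + b * (8 * c + E / 4) := by gcongr
        _ = b * (16 * c + E / 4) := by ring
        _ ≤ b * (E / 2) := by gcongr; linarith
    have h2 : b * (a * |(q₀ : ℝ) * x₁ - p₀|) ≤ b * (E / 2) := by
      rw [← mul_assoc, mul_comm b a, hab]; exact h1
    exact le_of_mul_le_mul_left h2 (by linarith)
  have br : b * |(q₀ : ℝ) * y₁ - r₀| ≤ E / u := by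
    have h1 : q₁ * |(q₀ : ℝ) * y₁ - r₀| ≤ M * E := by
      rw [er]
      calc q₁ * |(A₁ * F₂ - A₂ * F₁ : ℝ)| ≤ q₁ * (|(A₁ * F₂ : ℝ)| + |(A₂ * F₁ : ℝ)|) := by
            gcongr; exact abs_sub _ _
        _ = |(A₁ : ℝ)| * (q₁ * |F₂|) + |(A₂ : ℝ)| * (q₁ * |F₁|) := by
            rw [abs_mul, abs_mul]; ring
        _ ≤ M * (8 * c + E / 4) + 8 * M * (2 * c) := by gcongr
        _ = M * (24 * c + E / 4) := by ring
        _ ≤ M * E := by gcongr; linarith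
    have h2 : a * (b * |(q₀ : ℝ) * y₁ - r₀|) ≤ a * (E / u) := by
      rw [← mul_assoc, hab]
      calc q₁ * |(q₀ : ℝ) * y₁ - r₀| ≤ M * E := h1
        _ ≤ a / u * E := by gcongr
        _ = a * (E / u) := by ring
    exact le_of_mul_le_mul_left h2 (by linarith)
  have hEu : E / u < 1 := by rw [div_lt_one (by linarith)]; linarith
  have hau : u ≤ a := (le_mul_of_one_le_left (by linarith) hM1).trans hMu
  by_cases h0 : q₀ = 0
  · rw [h0] at bp br
    simp only [Int.cast_zero, zero_mul, zero_sub, abs_neg] at bp br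
    have hp : |(p₀ : ℝ)| < 1 := by nlinarith [abs_nonneg (p₀ : ℝ)]
    have hr : |(r₀ : ℝ)| < 1 := by nlinarith [abs_nonneg (r₀ : ℝ)]
    have hp' : p₀ = 0 := Int.abs_lt_one_iff.1 (by exact_mod_cast hp)
    have hr' : r₀ = 0 := Int.abs_lt_one_iff.1 (by exact_mod_cast hr)
    refine ⟨by linarith, by linarith, by linarith⟩
  · exfalso
    have key : (|(q₀ : ℝ)| ^ s * |(q₀ : ℝ) * x₁ - p₀| < c) ∧
        (|(q₀ : ℝ)| ^ t * |(q₀ : ℝ) * y₁ - r₀| < c) := by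
      have hk : ∀ k : ℝ, 0 < k → k ≤ 1 → |(q₀ : ℝ)| ^ k * u ^ k ≤ 12 * (q₁ : ℝ) ^ k := by
        intro k hk hk1
        calc |(q₀ : ℝ)| ^ k * u ^ k = (|(q₀ : ℝ)| * u) ^ k :=
              (Real.mul_rpow (abs_nonneg _) (by linarith)).symm
          _ ≤ (12 * q₁) ^ k := by gcongr
          _ = 12 ^ k * (q₁ : ℝ) ^ k := Real.mul_rpow (by norm_num) hQ.le
          _ ≤ 12 ^ (1 : ℝ) * (q₁ : ℝ) ^ k := by gcongr; norm_num
          _ = 12 * (q₁ : ℝ) ^ k := by rw [Real.rpow_one]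
      have hus0 : 0 < u ^ s := by positivity
      have hEc : 12 * E < c * u ^ s := by
        calc 12 * E ≤ 12 * e := by linarith
          _ < c * e * e := by gcongr
          _ = c * (e * e) := by ring
          _ ≤ c * u ^ s := by gcongr
      constructor
      · have h3 := hk s hs (by linarith)
        have : |(q₀ : ℝ)| ^ s * |(q₀ : ℝ) * x₁ - p₀| * u ^ s < c * u ^ s := by
          calc |(q₀ : ℝ)| ^ s * |(q₀ : ℝ) * x₁ - p₀| * u ^ s
              = (|(q₀ : ℝ)| ^ s * u ^ s) * |(q₀ : ℝ) * x₁ - p₀| := by ring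
            _ ≤ (12 * a) * |(q₀ : ℝ) * x₁ - p₀| := by gcongr
            _ ≤ 6 * E := by linarith
            _ < c * u ^ s := by linarith
        exact lt_of_mul_lt_mul_right this hus0.le
      · have h3 := hk t ht (by linarith)
        have hut : 1 ≤ u ^ t := Real.one_le_rpow hu ht.le
        have h4 : |(q₀ : ℝ)| ^ t ≤ 12 * b := by
          refine le_trans ?_ h3
          exact le_mul_of_one_le_right (by positivity) hut
        calc |(q₀ : ℝ)| ^ t * |(q₀ : ℝ) * y₁ - r₀| ≤ 12 * b * |(q₀ : ℝ) * y₁ - r₀| := by gcongr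
          _ ≤ 12 * (E / u) := by linarith
          _ = 12 * E / u := by ring
          _ < c := by
            rw [div_lt_iff₀ (by linarith)]
            calc 12 * E < c * u ^ s := hEc
              _ ≤ c * u := by gcongr
    have hlt : |q₀| < q₁ := by
      have : |(q₀ : ℝ)| < q₁ := by nlinarith [abs_nonneg (q₀ : ℝ)]
      exact_mod_cast this
    have hmul : ∀ (z : ℝ) (k : ℤ),
        |((|q₀| : ℤ) : ℝ) * z - ((q₀.sign * k : ℤ) : ℝ)| = |(q₀ : ℝ) * z - k| := by
      intro z k
      rcases lt_or_gt_of_ne h0 with h | h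
      · rw [Int.sign_eq_neg_one_of_neg h, abs_of_neg h]
        push_cast
        rw [← abs_neg]
        congr 1
        ring
      · rw [Int.sign_eq_one_of_pos h, abs_of_pos h]
        simp
    refine h₁.min |q₀| (q₀.sign * p₀) (q₀.sign * r₀) (abs_pos.2 h0) hlt ?_
    rw [hmul, hmul, Int.cast_abs]
    exact key

/-- Two non-proportional integer vectors orthogonal to the same two independent vectors. -/
lemma cross_eq_zero_of_forms_eq_zero (hs : 0 < s) (ht : 0 < t)
    (h₁ : IsFirstApprox s t c x₁ y₁ q₁ p₁ r₁) (h₂ : IsFirstApprox s t c x₂ y₂ q₂ p₂ r₂)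
    (l₁ : IsLineThrough s t q₁ p₁ r₁ A₁ B₁ C₁) (l₂ : IsLineThrough s t q₂ p₂ r₂ A₂ B₂ C₂)
    (hcanon : q₁ = q₂ → p₁ = p₂ → r₁ = r₂ → A₁ = A₂ ∧ B₁ = B₂ ∧ C₁ = C₂)
    (h12 : A₁ * p₂ + B₁ * r₂ + C₁ * q₂ = 0) (h21 : A₂ * p₁ + B₂ * r₁ + C₂ * q₁ = 0) :
    A₁ * B₂ = A₂ * B₁ ∧ A₁ * C₂ = A₂ * C₁ ∧ B₁ * C₂ = B₂ * C₁ := by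
  by_cases hp : q₁ * p₂ = q₂ * p₁ ∧ q₁ * r₂ = q₂ * r₁
  · obtain ⟨e1, e2, e3⟩ := h₁.eq_of_proportional hs ht h₂ hp.1 hp.2
    obtain ⟨rfl, rfl, rfl⟩ := hcanon e1 e2 e3
    exact ⟨rfl, rfl, rfl⟩
  · have e1 := l₁.eq
    have e2 := l₂.eq
    have q0 := h₁.pos.ne'
    have g1 : A₁ * (q₁ * p₂ - q₂ * p₁) + B₁ * (q₁ * r₂ - q₂ * r₁) = 0 := by
      linear_combination q₁ * h12 - q₂ * e1
    have g2 : A₂ * (q₁ * p₂ - q₂ * p₁) + B₂ * (q₁ * r₂ - q₂ * r₁) = 0 := by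
      linear_combination q₁ * e2 - q₂ * h21
    have hAB : A₁ * B₂ - A₂ * B₁ = 0 := by
      rw [not_and_or] at hp
      rcases hp with hp | hp
      · refine (mul_eq_zero.1 ?_).resolve_right (sub_ne_zero.2 hp)
        linear_combination B₂ * g1 - B₁ * g2
      · refine (mul_eq_zero.1 ?_).resolve_right (sub_ne_zero.2 hp)
        linear_combination A₁ * g2 - A₂ * g1
    refine ⟨by linarith, ?_, ?_⟩
    · refine mul_right_cancel₀ q0 ?_
      linear_combination A₁ * h21 - A₂ * e1 - r₁ * hAB
    · refine mul_right_cancel₀ q0 ?_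
      linear_combination B₁ * h21 - B₂ * e1 + p₁ * hAB

end

/-- Dyadic classes of pairs (denominator, size of the coefficients of the line). -/
structure IsInClass (s t : ℝ) (q : ℤ) (M : ℝ) (h j : ℕ) : Prop where
  height_ge : 2 ^ h ≤ q * M
  height_lt : q * M < 2 ^ (h + 1)
  slack_ge : 2 ^ j * M ≤ (q : ℝ) ^ max s t
  slack_lt : (q : ℝ) ^ max s t < 2 ^ (j + 1) * M

section

variable {s t c : ℝ}

lemma IsInClass.le_four_mul {q₁ q₂ : ℤ} {M₁ M₂ : ℝ} {h j : ℕ} (hs : 0 < s)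
    (hq₁ : 0 < q₁) (hq₂ : 0 < q₂)
    (k₁ : IsInClass s t q₁ M₁ h j) (k₂ : IsInClass s t q₂ M₂ h j) :
    (q₁ : ℝ) ≤ 4 * q₂ := by
  by_contra! hlt
  have hq₁' : (0 : ℝ) < q₁ := by exact_mod_cast hq₁
  have hq₂' : (0 : ℝ) < q₂ := by exact_mod_cast hq₂
  have hσ : 0 ≤ max s t := hs.le.trans (le_max_left _ _)
  have h1 : (q₂ : ℝ) ^ max s t ≤ (q₁ : ℝ) ^ max s t :=
    Real.rpow_le_rpow hq₂'.le (by linarith) hσ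
  have h2 : 0 < (q₂ : ℝ) ^ max s t := by positivity
  have h3 : (q₁ : ℝ) * (q₁ : ℝ) ^ max s t < 4 * q₂ * (q₂ : ℝ) ^ max s t := by
    calc (q₁ : ℝ) * (q₁ : ℝ) ^ max s t < q₁ * (2 ^ (j + 1) * M₁) := by
          gcongr; exact k₁.slack_lt
      _ = 2 ^ (j + 1) * (q₁ * M₁) := by ring
      _ ≤ 2 ^ (j + 1) * 2 ^ (h + 1) := by gcongr; exact k₁.height_lt.le
      _ = 4 * 2 ^ j * 2 ^ h := by ring
      _ ≤ 4 * 2 ^ j * (q₂ * M₂) := by gcongr; exact k₂.height_ge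
      _ = 4 * q₂ * (2 ^ j * M₂) := by ring
      _ ≤ 4 * q₂ * (q₂ : ℝ) ^ max s t := by gcongr; exact k₂.slack_ge
  have h4 : 4 * q₂ * (q₂ : ℝ) ^ max s t ≤ (q₁ : ℝ) * (q₁ : ℝ) ^ max s t := by gcongr
  linarith

/-- All lines attached to points of one class which are relevant to a ball coincide. -/
lemma cross_eq_zero_of_sameClass {ρ x₁ y₁ x₂ y₂ : ℝ}
    {q₁ p₁ r₁ A₁ B₁ C₁ q₂ p₂ r₂ A₂ B₂ C₂ : ℤ} {h j m : ℕ}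
    (hs : 0 < s) (ht : 0 < t) (hst : s + t = 1) (hc : c ≤ 1 / 64)
    (hm : 1 ≤ m) (hcm : 12 ≤ c * 2 ^ m)
    (h₁ : IsFirstApprox s t c x₁ y₁ q₁ p₁ r₁) (h₂ : IsFirstApprox s t c x₂ y₂ q₂ p₂ r₂)
    (l₁ : IsLineThrough s t q₁ p₁ r₁ A₁ B₁ C₁) (l₂ : IsLineThrough s t q₂ p₂ r₂ A₂ B₂ C₂)
    (hcanon : q₁ = q₂ → p₁ = p₂ → r₁ = r₂ → A₁ = A₂ ∧ B₁ = B₂ ∧ C₁ = C₂)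
    (k₁ : IsInClass s t q₁ (max |(A₁ : ℝ)| |(B₁ : ℝ)|) h j)
    (k₂ : IsInClass s t q₂ (max |(A₂ : ℝ)| |(B₂ : ℝ)|) h j)
    (hx : |x₁ - x₂| ≤ 2 * ρ) (hy : |y₁ - y₂| ≤ 2 * ρ)
    (hρ : ρ * 2 ^ h ≤ 2 ^ ((j : ℝ) / (4 * m)) / 256) :
    A₁ * B₂ = A₂ * B₁ ∧ A₁ * C₂ = A₂ * C₁ ∧ B₁ * C₂ = B₂ * C₁ := by
  have hq := k₁.le_four_mul hs h₁.pos h₂.pos k₂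
  have hq' := k₂.le_four_mul hs h₂.pos h₁.pos k₁
  have hq₁ := h₁.one_le
  have hq₂ := h₂.one_le
  have hM1 := l₁.ne
  have hM2 := l₂.ne
  have hm' : (1 : ℝ) ≤ m := by exact_mod_cast hm
  have hρ0 : 0 ≤ ρ := by linarith [abs_nonneg (x₁ - x₂)]
  set E : ℝ := 2 ^ ((j : ℝ) / (4 * m)) with hE
  have bound : ∀ {M q q' : ℝ}, 0 ≤ M → q * M < 2 ^ (h + 1) → q' ≤ 4 * q →
      ρ * M * q' ≤ E / 32 := by
    intro M q q' hM0 h1 h2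
    calc ρ * M * q' ≤ ρ * M * (4 * q) := by gcongr
      _ = 4 * ρ * (q * M) := by ring
      _ ≤ 4 * ρ * 2 ^ (h + 1) := by gcongr
      _ = 8 * (ρ * 2 ^ h) := by ring
      _ ≤ E / 32 := by linarith
  have b1 := bound (by linarith) k₁.height_lt hq'
  have b2 := bound (by linarith) k₂.height_lt hq
  have hE1 : 1 ≤ E := Real.one_le_rpow (by norm_num) (by positivity)
  rcases le_or_gt E 2 with hE2 | hE2
  · refine cross_eq_zero_of_forms_eq_zero hs ht h₁ h₂ l₁ l₂ hcanon ?_ ?_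
    · rw [abs_sub_comm] at hx hy
      exact form_eq_zero_of_near hs ht hst hc h₂ h₁ l₁ hx hy hq' hq (by linarith)
    · exact form_eq_zero_of_near hs ht hst hc h₁ h₂ l₂ hx hy hq hq' (by linarith)
  · set e : ℝ := 2 ^ ((j : ℝ) / 4) with he
    have heE : e = E ^ m := by
      rw [he, hE, ← Real.rpow_natCast, ← Real.rpow_mul (by norm_num)]
      congr 1
      field_simp
    have hEe : E ≤ e := heE ▸ le_self_pow₀ hE1 (by omega)
    have hce : 12 < c * e := by
      have c0 := h₁.const_pos
      have : (2 : ℝ) ^ m < E ^ m := by gcongr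
      calc 12 ≤ c * 2 ^ m := hcm
        _ < c * e := by rw [heE]; gcongr
    have heu : ∀ k : ℝ, 1 / 2 ≤ k → e * e ≤ ((2 : ℝ) ^ j) ^ k := by
      intro k hk
      rw [he, ← Real.rpow_add (by norm_num), ← Real.rpow_natCast, ← Real.rpow_mul (by norm_num)]
      refine Real.rpow_le_rpow_of_exponent_le (by norm_num) ?_
      have := mul_le_mul_of_nonneg_left hk (Nat.cast_nonneg (α := ℝ) j)
      linarith
    have hM : max |(A₂ : ℝ)| |(B₂ : ℝ)| ≤ 8 * max |(A₁ : ℝ)| |(B₁ : ℝ)| := by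
      have h2 : q₂ * max |(A₂ : ℝ)| |(B₂ : ℝ)| ≤ q₂ * (8 * max |(A₁ : ℝ)| |(B₁ : ℝ)|) := by
        calc q₂ * max |(A₂ : ℝ)| |(B₂ : ℝ)| ≤ 2 ^ (h + 1) := k₂.height_lt.le
          _ = 2 * 2 ^ h := by ring
          _ ≤ 2 * (q₁ * max |(A₁ : ℝ)| |(B₁ : ℝ)|) := by gcongr; exact k₁.height_ge
          _ ≤ 2 * (4 * q₂ * max |(A₁ : ℝ)| |(B₁ : ℝ)|) := by gcongr
          _ = _ := by ring
      exact le_of_mul_le_mul_left h2 (by linarith)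
    have hu : (1 : ℝ) ≤ 2 ^ j := one_le_pow₀ (by norm_num)
    have hk := k₁.slack_ge
    rw [mul_comm] at hk
    rcases le_total t s with hts | hts
    · rw [max_eq_left hts] at hk
      exact cross_eq_zero_of_flat hs ht hst hc h₁ h₂ l₁ l₂ hx hy hq hq' hM (by linarith)
        hu hk hE1 hEe (heu s (by linarith)) hce
    · rw [max_eq_right hts] at hk
      rw [max_comm |(A₁ : ℝ)|] at hk hM
      rw [max_comm |(A₂ : ℝ)|] at b2 hM
      obtain ⟨e1, e2, e3⟩ := cross_eq_zero_of_flat ht hs (by linarith) hc h₁.swap h₂.swap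
        l₁.swap l₂.swap hy hx hq hq' hM (by linarith) hu hk hE1 hEe (heu t (by linarith)) hce
      exact ⟨by linarith, e3, e2⟩

lemma exists_isInClass {q p r A B C : ℤ} (hs : 0 < s) (ht : 0 < t) (hst : s + t = 1)
    (hq : 0 < q) (l : IsLineThrough s t q p r A B C) :
    ∃ h j : ℕ, j ≤ h ∧ IsInClass s t q (max |(A : ℝ)| |(B : ℝ)|) h j := by
  have hM := l.ne
  have hq' : (1 : ℝ) ≤ q := by exact_mod_cast hq
  have hMq : max |(A : ℝ)| |(B : ℝ)| ≤ (q : ℝ) ^ max s t :=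
    max_le (l.left.trans (Real.rpow_le_rpow_of_exponent_le hq' (le_max_left _ _)))
      (l.right.trans (Real.rpow_le_rpow_of_exponent_le hq' (le_max_right _ _)))
  set M := max |(A : ℝ)| |(B : ℝ)|
  obtain ⟨h, h1, h2⟩ := exists_nat_pow_near (x := q * M) (y := 2) (by nlinarith) (by norm_num)
  obtain ⟨j, j1, j2⟩ := exists_nat_pow_near (x := (q : ℝ) ^ max s t / M) (y := 2)
    (by rwa [one_le_div (by linarith)]) (by norm_num)
  rw [le_div_iff₀ (by linarith)] at j1
  rw [div_lt_iff₀ (by linarith)] at j2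
  refine ⟨h, j, ?_, h1, h2, j1, j2⟩
  have hqq : (q : ℝ) ^ max s t ≤ q := by
    calc (q : ℝ) ^ max s t ≤ (q : ℝ) ^ (1 : ℝ) :=
          Real.rpow_le_rpow_of_exponent_le hq' (max_le (by linarith [ht]) (by linarith [hs]))
      _ = q := Real.rpow_one _
  have : (2 : ℝ) ^ j < 2 ^ (h + 1) := by
    calc (2 : ℝ) ^ j ≤ 2 ^ j * M := le_mul_of_one_le_right (by positivity) hM
      _ ≤ q := j1.trans hqq
      _ ≤ q * M := le_mul_of_one_le_right (by linarith) hM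
      _ < 2 ^ (h + 1) := h2
  have := (pow_lt_pow_iff_right₀ (by norm_num : (1 : ℝ) < 2)).1 this
  omega

lemma exists_isLineThrough (hst : s + t = 1) {q : ℤ} (hq : 0 < q)
    (p r : ℤ) : ∃ A B C : ℤ, IsLineThrough s t q p r A B C := by
  have hq' : (0 : ℝ) < q := by exact_mod_cast hq
  set a := ⌊(q : ℝ) ^ s⌋₊ with ha
  set b := ⌊(q : ℝ) ^ t⌋₊ with hb
  have hcard : (Finset.Ico (0 : ℤ) q).card
      < (Finset.range (a + 1) ×ˢ Finset.range (b + 1)).card := by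
    rw [Int.card_Ico, Finset.card_product, Finset.card_range, Finset.card_range]
    have h1 : (q : ℝ) < ((a + 1) * (b + 1) : ℕ) := by
      have e : (q : ℝ) = (q : ℝ) ^ s * (q : ℝ) ^ t := by
        rw [← Real.rpow_add hq', hst, Real.rpow_one]
      rw [e]
      push_cast
      exact mul_lt_mul'' (Nat.lt_floor_add_one _) (Nat.lt_floor_add_one _)
        (by positivity) (by positivity)
    have h2 : q < ((a + 1) * (b + 1) : ℕ) := by exact_mod_cast h1
    omega
  obtain ⟨u, hu, v, hv, huv, hmod⟩ := Finset.exists_ne_map_eq_of_card_lt_of_maps_to hcard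
    (f := fun u : ℕ × ℕ => ((u.1 : ℤ) * p + u.2 * r) % q)
    (fun u _ => by
      simp only [Finset.coe_Ico, Set.mem_Ico]
      exact ⟨Int.emod_nonneg _ hq.ne', Int.emod_lt_of_pos _ hq⟩)
  simp only [Finset.mem_product, Finset.mem_range] at hu hv
  obtain ⟨C, hC⟩ := Int.ModEq.dvd (show _ ≡ _ [ZMOD q] from hmod)
  have size : ∀ {k : ℝ} {m n : ℕ}, m < ⌊k⌋₊ + 1 → n < ⌊k⌋₊ + 1 → 0 ≤ k →
      |(((m : ℤ) - n : ℤ) : ℝ)| ≤ k := by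
    intro k m n hm hn hk
    have hm' : (m : ℝ) ≤ k := le_trans (by exact_mod_cast Nat.lt_succ_iff.1 hm) (Nat.floor_le hk)
    have hn' : (n : ℝ) ≤ k := le_trans (by exact_mod_cast Nat.lt_succ_iff.1 hn) (Nat.floor_le hk)
    push_cast
    rw [abs_le]
    constructor <;> linarith [Nat.cast_nonneg (α := ℝ) m, Nat.cast_nonneg (α := ℝ) n]
  refine ⟨u.1 - v.1, u.2 - v.2, C, by linarith, size hu.1 hv.1 (by positivity),
    size hu.2 hv.2 (by positivity), ?_⟩
  have one_le : ∀ {m n : ℕ}, m ≠ n → 1 ≤ |(((m : ℤ) - n : ℤ) : ℝ)| := by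
    intro m n hmn
    have : 1 ≤ |(m : ℤ) - n| := Int.one_le_abs (by omega)
    exact_mod_cast this
  by_cases h1 : u.1 = v.1
  · have h2 : u.2 ≠ v.2 := fun h2 => huv (Prod.ext h1 h2)
    exact le_max_of_le_right (one_le h2)
  · exact le_max_of_le_left (one_le h1)

end

/-- The line through a point with given normal vector. -/
def lineOfNormal (P : ℝ × ℝ) (a b : ℝ) : AffineSubspace ℝ (ℝ × ℝ) :=
  AffineSubspace.mk' P (Submodule.span ℝ {(b, -a)})

lemma isLine_lineOfNormal (P : ℝ × ℝ) {a b : ℝ} (h : a ≠ 0 ∨ b ≠ 0) :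
    IsLine (lineOfNormal P a b) := by
  refine ⟨AffineSubspace.mk'_nonempty _ _, ?_⟩
  rw [lineOfNormal, AffineSubspace.direction_mk']
  refine finrank_span_singleton ?_
  simpa [Prod.ext_iff, or_iff_not_imp_right, not_and_or, imp_not_comm] using h.symm

lemma mul_infDist_lineOfNormal_le (P X : ℝ × ℝ) (a b : ℝ) :
    max |a| |b| * infDist X (lineOfNormal P a b : Set (ℝ × ℝ))
      ≤ |a * (X.1 - P.1) + b * (X.2 - P.2)| := by
  set F := a * (X.1 - P.1) + b * (X.2 - P.2) with hF
  rcases le_total |b| |a| with hab | hab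
  · rw [max_eq_left hab]
    rcases eq_or_ne a 0 with rfl | ha
    · simp
    have hmem : (X.1 - F / a, X.2) ∈ (lineOfNormal P a b : Set (ℝ × ℝ)) := by
      rw [SetLike.mem_coe, lineOfNormal, AffineSubspace.mem_mk', Submodule.mem_span_singleton]
      refine ⟨-(X.2 - P.2) / a, ?_⟩
      ext
      · simp [hF]; field_simp; ring
      · simp only [Prod.smul_mk, smul_eq_mul, vsub_eq_sub, Prod.snd_sub]
        field_simp
    have hd : infDist X (lineOfNormal P a b : Set (ℝ × ℝ)) ≤ |F / a| := by
      refine (infDist_le_dist_of_mem hmem).trans (le_of_eq ?_)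
      rw [Prod.dist_eq]
      simp [abs_div]
      positivity
    calc |a| * infDist X (lineOfNormal P a b : Set (ℝ × ℝ)) ≤ |a| * |F / a| := by gcongr
      _ = |F| := by rw [← abs_mul, mul_div_cancel₀ _ ha]
  · rw [max_eq_right hab]
    rcases eq_or_ne b 0 with rfl | hb
    · simp
    have hmem : (X.1, X.2 - F / b) ∈ (lineOfNormal P a b : Set (ℝ × ℝ)) := by
      rw [SetLike.mem_coe, lineOfNormal, AffineSubspace.mem_mk', Submodule.mem_span_singleton]
      refine ⟨(X.1 - P.1) / b, ?_⟩
      ext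
      · simp; field_simp
      · simp [hF]; field_simp; ring
    have hd : infDist X (lineOfNormal P a b : Set (ℝ × ℝ)) ≤ |F / b| := by
      refine (infDist_le_dist_of_mem hmem).trans (le_of_eq ?_)
      rw [Prod.dist_eq]
      simp [abs_div]
      positivity
    calc |b| * infDist X (lineOfNormal P a b : Set (ℝ × ℝ)) ≤ |b| * |F / b| := by gcongr
      _ = |F| := by rw [← abs_mul, mul_div_cancel₀ _ hb]

/-- If a proportional form is small at a point, the point is close to the line. -/
lemma infDist_lineOfNormal_le {q₁ p₁ r₁ A₁ B₁ C₁ q₂ p₂ r₂ A₂ B₂ C₂ : ℤ} {s t c : ℝ}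
    {X : ℝ × ℝ} {h j : ℕ} (hq₂ : 0 < q₂)
    (h₁ : IsFirstApprox s t c X.1 X.2 q₁ p₁ r₁)
    (l₁ : IsLineThrough s t q₁ p₁ r₁ A₁ B₁ C₁) (l₂ : IsLineThrough s t q₂ p₂ r₂ A₂ B₂ C₂)
    (k₁ : IsInClass s t q₁ (max |(A₁ : ℝ)| |(B₁ : ℝ)|) h j)
    (hcross : A₁ * B₂ = A₂ * B₁ ∧ A₁ * C₂ = A₂ * C₁ ∧ B₁ * C₂ = B₂ * C₁) :
    infDist X (lineOfNormal ((p₂ : ℝ) / q₂, (r₂ : ℝ) / q₂) A₂ B₂ : Set (ℝ × ℝ))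
      ≤ 2 * c / 2 ^ h := by
  have hq₂' : (q₂ : ℝ) ≠ 0 := by exact_mod_cast hq₂.ne'
  have d := mul_infDist_lineOfNormal_le ((p₂ : ℝ) / q₂, (r₂ : ℝ) / q₂) X A₂ B₂
  have e₂ : (A₂ * p₂ + B₂ * r₂ + C₂ * q₂ : ℝ) = 0 := by exact_mod_cast l₂.eq
  have eF : (A₂ : ℝ) * (X.1 - (p₂ : ℝ) / q₂) + B₂ * (X.2 - (r₂ : ℝ) / q₂)
      = A₂ * X.1 + B₂ * X.2 + C₂ := by
    field_simp
    linear_combination -e₂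
  rw [eF] at d
  set D := infDist X (lineOfNormal ((p₂ : ℝ) / q₂, (r₂ : ℝ) / q₂) A₂ B₂ : Set (ℝ × ℝ))
  have hD : 0 ≤ D := infDist_nonneg
  obtain ⟨c1, c2, c3⟩ := hcross
  have c1' : (A₁ * B₂ : ℝ) = A₂ * B₁ := by exact_mod_cast c1
  have c2' : (A₁ * C₂ : ℝ) = A₂ * C₁ := by exact_mod_cast c2
  have c3' : (B₁ * C₂ : ℝ) = B₂ * C₁ := by exact_mod_cast c3
  have n := h₁.mul_abs_form_le l₁
  set F₁ : ℝ := A₁ * X.1 + B₁ * X.2 + C₁ with hF₁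
  set F₂ : ℝ := A₂ * X.1 + B₂ * X.2 + C₂ with hF₂
  have g1 : |(A₁ : ℝ)| * |F₂| = |(A₂ : ℝ)| * |F₁| := by
    rw [← abs_mul, ← abs_mul]; congr 1
    rw [hF₁, hF₂]; linear_combination X.2 * c1' + c2'
  have g2 : |(B₁ : ℝ)| * |F₂| = |(B₂ : ℝ)| * |F₁| := by
    rw [← abs_mul, ← abs_mul]; congr 1
    rw [hF₁, hF₂]; linear_combination -X.1 * c1' + c3'
  have hM2 := l₂.ne
  have hA₂ : |(A₂ : ℝ)| ≤ max |(A₂ : ℝ)| |(B₂ : ℝ)| := le_max_left _ _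
  have hB₂ : |(B₂ : ℝ)| ≤ max |(A₂ : ℝ)| |(B₂ : ℝ)| := le_max_right _ _
  have kh := k₁.height_ge
  have g3 : max |(A₁ : ℝ)| |(B₁ : ℝ)| * |F₂| ≤ max |(A₂ : ℝ)| |(B₂ : ℝ)| * |F₁| := by
    rw [max_mul_of_nonneg _ _ (abs_nonneg _)]
    refine max_le ?_ ?_
    · rw [g1]; gcongr
    · rw [g2]; gcongr
  have hM1 := l₁.ne
  have hq₁ := h₁.one_le
  set M₁ := max |(A₁ : ℝ)| |(B₁ : ℝ)|
  set M₂ := max |(A₂ : ℝ)| |(B₂ : ℝ)|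
  have g4 : M₁ * D ≤ |F₁| := by
    refine le_of_mul_le_mul_left (a := M₂) ?_ (by linarith)
    calc M₂ * (M₁ * D) = M₁ * (M₂ * D) := by ring
      _ ≤ M₁ * |F₂| := by gcongr
      _ ≤ M₂ * |F₁| := g3
  rw [le_div_iff₀ (by positivity)]
  calc D * 2 ^ h ≤ D * (q₁ * M₁) := by gcongr
    _ = q₁ * (M₁ * D) := by ring
    _ ≤ q₁ * |F₁| := by gcongr
    _ ≤ 2 * c := n

/-- Points outside `badPair` are approximated with arbitrarily small constants. -/
lemma exists_isFirstApprox_of_notMem_badPair {s t c : ℝ} {X : ℝ × ℝ} (hX : X ∉ badPair s t)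
    (hc : 0 < c) : ∃ q p r : ℤ, IsFirstApprox s t c X.1 X.2 q p r := by
  classical
  have hex : ∃ q : ℕ, 0 < q ∧ ∃ p r : ℤ,
      (q : ℝ) ^ s * |q * X.1 - p| < c ∧ (q : ℝ) ^ t * |q * X.2 - r| < c := by
    by_contra! hcon
    refine hX (lt_of_lt_of_le hc (le_ciInf fun q => ?_))
    by_contra! hlt
    rw [max_lt_iff] at hlt
    exact absurd hlt.2 (not_lt.2 (hcon q q.pos _ _ hlt.1))
  obtain ⟨hpos, p, r, h1, h2⟩ := Nat.find_spec hex
  refine ⟨Nat.find hex, p, r, by exact_mod_cast hpos, by exact_mod_cast h1,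
    by exact_mod_cast h2, ?_⟩
  rintro q' p' r' h0 hlt h'
  lift q' to ℕ using h0.le
  refine Nat.find_min hex (by exact_mod_cast hlt) ⟨by exact_mod_cast h0, p', r', ?_⟩
  exact_mod_cast h'

lemma summable_ite_pow_le {a K : ℝ} (ha : 0 < a) (ha1 : a < 1) :
    Summable fun h : ℕ => if a ^ h ≤ K then a ^ h else 0 := by
  refine Summable.of_nonneg_of_le (fun h => ?_) (fun h => ?_)
    (summable_geometric_of_lt_one ha.le ha1)
  · split_ifs <;> positivity
  · split_ifs
    · exact le_rfl
    · positivity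

/-- The sum of the terms of a geometric series below a threshold. -/
lemma tsum_ite_pow_le {a K : ℝ} (ha : 0 < a) (ha1 : a < 1) (hK : 0 < K) :
    ∑' h : ℕ, (if a ^ h ≤ K then a ^ h else 0) ≤ K / (1 - a) := by
  classical
  have hex : ∃ n : ℕ, a ^ n ≤ K := (exists_pow_lt_of_lt_one hK ha1).imp fun _ h => h.le
  have hn := Nat.find_spec hex
  have hmin : ∀ i < Nat.find hex, ¬ a ^ i ≤ K := fun i hi => Nat.find_min hex hi
  set n := Nat.find hex
  rw [← (summable_ite_pow_le ha ha1).sum_add_tsum_nat_add n,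
    Finset.sum_eq_zero (fun i hi => if_neg (hmin i (Finset.mem_range.1 hi))), zero_add]
  have e : ∀ i : ℕ, (if a ^ (i + n) ≤ K then a ^ (i + n) else 0) = a ^ n * a ^ i := by
    intro i
    rw [if_pos, pow_add, mul_comm]
    exact (pow_le_pow_of_le_one ha.le ha1.le (Nat.le_add_left n i)).trans hn
  simp_rw [e]
  rw [tsum_mul_left, tsum_geometric_of_lt_one ha.le ha1, ← div_eq_mul_inv]
  have : 0 < 1 - a := by linarith
  gcongr

/-- A double series of nonnegative terms is bounded through bounds for its rows. -/
lemma summable_prod_and_tsum_le {f : ℕ × ℕ → ℝ} {g : ℕ → ℝ} (hf : ∀ v, 0 ≤ f v)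
    (hrow : ∀ j, Summable fun h => f (j, h)) (hle : ∀ j, ∑' h, f (j, h) ≤ g j)
    (hg : Summable g) : Summable f ∧ ∑' v, f v ≤ ∑' j, g j := by
  have hs : Summable fun j => ∑' h, f (j, h) :=
    Summable.of_nonneg_of_le (fun j => tsum_nonneg fun h => hf (j, h)) hle hg
  have hsum : Summable f := (summable_prod_of_nonneg hf).2 ⟨hrow, hs⟩
  exact ⟨hsum, by rw [hsum.tsum_prod]; exact hs.tsum_le_tsum hle hg⟩

lemma summable_prod_ite_pow_le {a b K : ℝ} (ha : 0 < a) (ha1 : a < 1) (hb : 0 < b) (hb1 : b < 1)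
    (hK : 0 < K) :
    Summable (fun v : ℕ × ℕ => if a ^ v.2 ≤ K * b ^ v.1 then a ^ v.2 else 0) ∧
      ∑' v : ℕ × ℕ, (if a ^ v.2 ≤ K * b ^ v.1 then a ^ v.2 else 0)
        ≤ K / ((1 - a) * (1 - b)) := by
  have h1 : 0 < 1 - a := by linarith
  have h2 : 0 < 1 - b := by linarith
  have total : ∑' j : ℕ, K / (1 - a) * b ^ j = K / ((1 - a) * (1 - b)) := by
    rw [tsum_mul_left, tsum_geometric_of_lt_one hb.le hb1]
    field_simp
  have nonneg : ∀ v : ℕ × ℕ, (0 : ℝ) ≤ if a ^ v.2 ≤ K * b ^ v.1 then a ^ v.2 else 0 := by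
    intro v
    split_ifs
    · exact (pow_pos ha _).le
    · exact le_rfl
  have row : ∀ j : ℕ, ∑' h : ℕ, (if a ^ h ≤ K * b ^ j then a ^ h else 0)
      ≤ K / (1 - a) * b ^ j := by
    intro j
    have h := tsum_ite_pow_le (K := K * b ^ j) ha ha1 (mul_pos hK (pow_pos hb j))
    rwa [mul_div_right_comm] at h
  have both := summable_prod_and_tsum_le
    (f := fun v : ℕ × ℕ => if a ^ v.2 ≤ K * b ^ v.1 then a ^ v.2 else 0)
    (g := fun j => K / (1 - a) * b ^ j) nonneg
    (fun j => summable_ite_pow_le (K := K * b ^ j) ha ha1) row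
    ((summable_geometric_of_lt_one hb.le hb1).mul_left _)
  exact ⟨both.1, both.2.trans_eq total⟩

/-- The choice of the approximation constant `12 / 2 ^ m`. -/
lemma exists_approx_exponent {γ D : ℝ} (C : ℝ) (hγ : 0 < γ) (hD : 0 < D) :
    ∃ m : ℕ, 1 ≤ m ∧ (12 : ℝ) / 2 ^ m ≤ 1 / 64 ∧
      C * ((2 : ℝ) ^ (-γ)) ^ m ≤ D * (1 - (2 : ℝ) ^ (-γ / (4 * m))) := by
  have hl := Real.log_pos one_lt_two
  set k := γ * Real.log 2 / 4 with hk
  have hk0 : 0 < k := by positivity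
  set a : ℝ := (2 : ℝ) ^ (-γ) with ha
  have ha0 : 0 < a := by positivity
  have ha1 : a < 1 := Real.rpow_lt_one_of_one_lt_of_neg one_lt_two (by linarith)
  have hlim : Tendsto (fun m : ℕ => |C| * (a ^ m + k⁻¹ * (m * a ^ m))) atTop (nhds 0) := by
    simpa using ((tendsto_pow_atTop_nhds_zero_of_lt_one ha0.le ha1).add
      ((tendsto_self_mul_const_pow_of_lt_one ha0.le ha1).const_mul k⁻¹)).const_mul |C|
  have hlim' : Tendsto (fun m : ℕ => (12 : ℝ) * (1 / 2) ^ m) atTop (nhds 0) := by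
    simpa using (tendsto_pow_atTop_nhds_zero_of_lt_one (by norm_num)
      (by norm_num : (1 / 2 : ℝ) < 1)).const_mul 12
  obtain ⟨m, h1, h2, h3⟩ := ((hlim.eventually_le_const hD).and
    ((hlim'.eventually_le_const (by norm_num : (0 : ℝ) < 1 / 64)).and
      (eventually_ge_atTop 1))).exists
  refine ⟨m, h3, ?_, ?_⟩
  · rwa [one_div_pow, mul_one_div] at h2
  have hm : (0 : ℝ) < m := by exact_mod_cast h3
  have e : (2 : ℝ) ^ (-γ / (4 * m)) = Real.exp (-(k / m)) := by
    rw [Real.rpow_def_of_pos (by norm_num), hk]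
    congr 1
    field_simp
  have hy : 0 < k / m := by positivity
  have h4 : Real.exp (-(k / m)) ≤ 1 / (1 + k / m) := by
    rw [Real.exp_neg, ← one_div]
    gcongr
    linarith [Real.add_one_le_exp (k / m)]
  have h5 : k / m / (1 + k / m) ≤ 1 - (2 : ℝ) ^ (-γ / (4 * m)) := by
    rw [e]
    have : k / m / (1 + k / m) = 1 - 1 / (1 + k / m) := by field_simp; ring
    linarith
  calc C * a ^ m ≤ |C| * a ^ m := by gcongr; exact le_abs_self C
    _ = |C| * (a ^ m + k⁻¹ * (m * a ^ m)) * (k / m / (1 + k / m)) := by field_simp; ring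
    _ ≤ D * (k / m / (1 + k / m)) := by gcongr
    _ ≤ D * (1 - (2 : ℝ) ^ (-γ / (4 * m))) := by gcongr

/-- The thickness budget: the neighbourhoods of all classes that are not too coarse compared with
the current ball of radius `r`. -/
lemma exists_exponent_budget {β γ η : ℝ} (hβ : 0 < β) (hγ : 0 < γ) (hη : 0 < η) :
    ∃ m : ℕ, 1 ≤ m ∧ (12 : ℝ) / 2 ^ m ≤ 1 / 64 ∧ ∀ r : ℝ, 0 < r →
      Summable (fun v : ℕ × ℕ =>
        (if η * 2 ^ ((v.1 : ℝ) / (4 * m)) / 2 ^ v.2 ≤ r / β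
          then 2 * ((12 : ℝ) / 2 ^ m) / 2 ^ v.2 else 0) ^ γ) ∧
      ∑' v : ℕ × ℕ,
        (if η * 2 ^ ((v.1 : ℝ) / (4 * m)) / 2 ^ v.2 ≤ r / β
          then 2 * ((12 : ℝ) / 2 ^ m) / 2 ^ v.2 else 0) ^ γ ≤ (β * r) ^ γ := by
  set a : ℝ := (2 : ℝ) ^ (-γ) with ha
  have ha0 : 0 < a := by positivity
  have ha1 : a < 1 := Real.rpow_lt_one_of_one_lt_of_neg one_lt_two (by linarith)
  have ha2 : 0 < 1 - a := by linarith
  obtain ⟨m, hm, hm64, hbound⟩ := exists_approx_exponent (D := (1 - a) * β ^ γ)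
    (24 ^ γ * (1 / (β * η)) ^ γ) hγ (by positivity)
  refine ⟨m, hm, hm64, fun r hr => ?_⟩
  have hm' : (0 : ℝ) < m := by exact_mod_cast hm
  set b : ℝ := (2 : ℝ) ^ (-γ / (4 * m)) with hb
  have hb0 : 0 < b := by positivity
  have hb1 : b < 1 := Real.rpow_lt_one_of_one_lt_of_neg one_lt_two
    (div_neg_of_neg_of_pos (by linarith) (by positivity))
  set K : ℝ := (r / β / η) ^ γ with hK
  have hK0 : 0 < K := by positivity
  set c : ℝ := 12 / 2 ^ m with hc
  have hc0 : 0 < c := by positivity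
  obtain ⟨hs, hle⟩ := summable_prod_ite_pow_le ha0 ha1 hb0 hb1 hK0
  have pw : ∀ n : ℕ, a ^ n = (1 / 2 ^ n : ℝ) ^ γ := by
    intro n
    rw [ha, ← Real.rpow_natCast, ← Real.rpow_mul (by norm_num), one_div, Real.inv_rpow (by positivity),
      ← Real.rpow_natCast, ← Real.rpow_mul (by norm_num), ← Real.rpow_neg (by norm_num)]
    congr 1
    ring
  have pb : ∀ n : ℕ, b ^ n = (1 / 2 ^ ((n : ℝ) / (4 * m)) : ℝ) ^ γ := by
    intro n
    rw [hb, ← Real.rpow_natCast, ← Real.rpow_mul (by norm_num), one_div, Real.inv_rpow (by positivity),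
      ← Real.rpow_mul (by norm_num), ← Real.rpow_neg (by norm_num)]
    congr 1
    ring
  have term : ∀ v : ℕ × ℕ,
      (if η * 2 ^ ((v.1 : ℝ) / (4 * m)) / 2 ^ v.2 ≤ r / β
          then 2 * c / 2 ^ v.2 else 0) ^ γ
        ≤ (2 * c) ^ γ * (if a ^ v.2 ≤ K * b ^ v.1 then a ^ v.2 else 0) := by
    rintro ⟨j, h⟩
    dsimp only
    by_cases hv : η * 2 ^ ((j : ℝ) / (4 * m)) / 2 ^ h ≤ r / β
    · rw [if_pos hv, if_pos]
      · rw [pw, ← Real.mul_rpow (by positivity) (by positivity), mul_one_div]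
      · rw [pw, pb, hK, ← Real.mul_rpow (by positivity) (by positivity)]
        refine Real.rpow_le_rpow (by positivity) ?_ hγ.le
        rw [mul_one_div, le_div_iff₀ (by positivity), le_div_iff₀ hη]
        refine le_trans (le_of_eq ?_) hv
        ring
    · rw [if_neg hv, Real.zero_rpow hγ.ne']
      split_ifs <;> positivity
  have hs' := hs.mul_left ((2 * c) ^ γ)
  have hsum := Summable.of_nonneg_of_le (fun v => by split_ifs <;> positivity) term hs'
  refine ⟨hsum, (hsum.tsum_le_tsum term hs').trans ?_⟩
  rw [tsum_mul_left]
  have hb2 : 0 < 1 - b := by linarith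
  calc (2 * c) ^ γ * ∑' v : ℕ × ℕ, (if a ^ v.2 ≤ K * b ^ v.1 then a ^ v.2 else 0)
      ≤ (2 * c) ^ γ * (K / ((1 - a) * (1 - b))) := by gcongr
    _ = (24 ^ γ * (1 / (β * η)) ^ γ * a ^ m) * r ^ γ / ((1 - a) * (1 - b)) := by
      have e1 : (2 * c) ^ γ = 24 ^ γ * a ^ m := by
        rw [pw, ← Real.mul_rpow (by norm_num) (by positivity), hc]
        congr 1
        ring
      have e2 : K = (1 / (β * η)) ^ γ * r ^ γ := by
        rw [hK, ← Real.mul_rpow (by positivity) hr.le]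
        congr 1
        field_simp
      rw [e1, e2]
      ring
    _ ≤ ((1 - a) * β ^ γ * (1 - b)) * r ^ γ / ((1 - a) * (1 - b)) := by gcongr
    _ = (β * r) ^ γ := by
      rw [Real.mul_rpow hβ.le hr.le]
      field_simp

/-- To each ball and each class corresponds one line, close to all points of the ball whose
first approximation lies in the class. -/
lemma exists_line_of_class {s t c η : ℝ} {m : ℕ} (hs : 0 < s) (ht : 0 < t) (hst : s + t = 1)
    (hc : c ≤ 1 / 64) (hm : 1 ≤ m) (hcm : 12 ≤ c * 2 ^ m) (hη : η ≤ 1 / 256) :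
    ∃ L : (ℝ × ℝ) × ℝ → ℕ → ℕ → AffineSubspace ℝ (ℝ × ℝ),
      (∀ b j h, IsLine (L b j h)) ∧
      ∀ (X : ℝ × ℝ) (q p r : ℤ), IsFirstApprox s t c X.1 X.2 q p r → ∃ h j : ℕ, j ≤ h ∧
        ∀ b : (ℝ × ℝ) × ℝ, X ∈ closedBall b.1 b.2 → b.2 ≤ η * 2 ^ ((j : ℝ) / (4 * m)) / 2 ^ h →
          infDist X (L b j h : Set (ℝ × ℝ)) ≤ 2 * c / 2 ^ h := by
  classical
  have hex : ∀ q p r : ℤ, ∃ A B C : ℤ, 0 < q → IsLineThrough s t q p r A B C := by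
    intro q p r
    by_cases hq : 0 < q
    · obtain ⟨A, B, C, h⟩ := exists_isLineThrough hst hq p r
      exact ⟨A, B, C, fun _ => h⟩
    · exact ⟨0, 0, 0, fun h => absurd h hq⟩
  choose A B C hl using hex
  have hL : ∀ (b : (ℝ × ℝ) × ℝ) (j h : ℕ), ∃ L : AffineSubspace ℝ (ℝ × ℝ), IsLine L ∧
      (b.2 ≤ η * 2 ^ ((j : ℝ) / (4 * m)) / 2 ^ h →
        ∀ (X : ℝ × ℝ) (q p r : ℤ), X ∈ closedBall b.1 b.2 →
          IsFirstApprox s t c X.1 X.2 q p r →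
          IsInClass s t q (max |(A q p r : ℝ)| |(B q p r : ℝ)|) h j →
          infDist X (L : Set (ℝ × ℝ)) ≤ 2 * c / 2 ^ h) := by
    intro b j h
    by_cases hit : ∃ (Y : ℝ × ℝ) (q p r : ℤ), Y ∈ closedBall b.1 b.2 ∧
          IsFirstApprox s t c Y.1 Y.2 q p r ∧
          IsInClass s t q (max |(A q p r : ℝ)| |(B q p r : ℝ)|) h j
    · obtain ⟨Y, q₂, p₂, r₂, hY, h₂, k₂⟩ := hit
      have l₂ := hl q₂ p₂ r₂ h₂.pos
      refine ⟨lineOfNormal ((p₂ : ℝ) / q₂, (r₂ : ℝ) / q₂) (A q₂ p₂ r₂) (B q₂ p₂ r₂),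
        isLine_lineOfNormal _ ?_, ?_⟩
      · by_contra! h0
        have := l₂.ne
        rw [h0.1, h0.2] at this
        norm_num at this
      · intro hρ X q₁ p₁ r₁ hX h₁ k₁
        have l₁ := hl q₁ p₁ r₁ h₁.pos
        have hXY : dist X Y ≤ 2 * b.2 := by
          have := dist_triangle_right X Y b.1
          rw [mem_closedBall] at hX hY
          linarith
        rw [Prod.dist_eq, max_le_iff, Real.dist_eq, Real.dist_eq] at hXY
        refine infDist_lineOfNormal_le h₂.pos h₁ l₁ l₂ k₁
          (cross_eq_zero_of_sameClass hs ht hst hc hm hcm h₁ h₂ l₁ l₂ ?_ k₁ k₂ hXY.1 hXY.2 ?_)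
        · rintro rfl rfl rfl
          exact ⟨rfl, rfl, rfl⟩
        · rw [le_div_iff₀ (by positivity)] at hρ
          have : η * (2 : ℝ) ^ ((j : ℝ) / (4 * m)) ≤ 1 / 256 * (2 : ℝ) ^ ((j : ℝ) / (4 * m)) := by
            gcongr
          linarith
    · refine ⟨lineOfNormal 0 1 0, isLine_lineOfNormal _ (Or.inl one_ne_zero), ?_⟩
      intro _ X q p r hX h₁ k₁
      exact absurd ⟨X, q, p, r, hX, h₁, k₁⟩ hit
  choose L hLine hLdist using hL
  refine ⟨L, hLine, fun X q p r h₁ => ?_⟩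
  obtain ⟨h, j, hj, k₁⟩ := exists_isInClass hs ht hst h₁.pos (hl q p r h₁.pos)
  exact ⟨h, j, hj, fun b hX hρ => hLdist b j h hρ X q p r hX h₁ k₁⟩

/-- A strategy depending only on the current ball, winning when the first ball is not too small
compared with `η`. -/
lemma exists_positional_strategy {s t β γ η : ℝ} (hs : 0 < s) (ht : 0 < t) (hst : s + t = 1)
    (hβ : 0 < β) (hβ1 : β ≤ 1) (hγ : 0 < γ) (hη : 0 < η) (hη1 : η ≤ 1 / 256) :
    ∃ τ : (ℝ × ℝ) × ℝ → ℕ → AffineSubspace ℝ (ℝ × ℝ) × ℝ,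
      (∀ b : (ℝ × ℝ) × ℝ, 0 < b.2 →
        (∀ i : ℕ, 0 ≤ (τ b i).2 ∧ (0 < (τ b i).2 → IsLine (τ b i).1)) ∧
        Summable (fun i : ℕ => (τ b i).2 ^ γ) ∧
        (∑' i : ℕ, (τ b i).2 ^ γ) ≤ (β * b.2) ^ γ) ∧
      ∀ B : ℕ → (ℝ × ℝ) × ℝ, η ≤ (B 0).2 → (∀ n, β * (B n).2 ≤ (B (n + 1)).2) →
        Tendsto (fun n => (B n).2) atTop (nhds 0) →
        ∀ X : ℝ × ℝ, (∀ n, X ∈ closedBall (B n).1 (B n).2) → X ∉ badPair s t →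
          ∃ n i : ℕ, 0 < (τ (B n) i).2 ∧ X ∈ lineNbhd (τ (B n) i).1 (τ (B n) i).2 := by
  classical
  obtain ⟨m, hm, hm64, hbudget⟩ := exists_exponent_budget hβ hγ hη
  obtain ⟨L, hLine, hL⟩ := exists_line_of_class hs ht hst hm64 hm
    (div_mul_cancel₀ (12 : ℝ) (by positivity)).ge hη1
  set c : ℝ := 12 / 2 ^ m with hc
  have hc0 : 0 < c := by positivity
  let w : ℝ → ℕ × ℕ → ℝ := fun r v =>
    if η * 2 ^ ((v.1 : ℝ) / (4 * m)) / 2 ^ v.2 ≤ r / β then 2 * c / 2 ^ v.2 else 0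
  refine ⟨fun b i => (L b i.unpair.1 i.unpair.2, w b.2 i.unpair), fun b hb => ⟨fun i => ?_, ?_⟩, ?_⟩
  · refine ⟨?_, fun _ => hLine _ _ _⟩
    dsimp only [w]
    split_ifs <;> positivity
  · obtain ⟨h1, h2⟩ := hbudget b.2 hb
    refine ⟨(Nat.pairEquiv.symm.summable_iff (f := fun v => w b.2 v ^ γ)).2 h1, ?_⟩
    exact (Nat.pairEquiv.symm.tsum_eq (fun v => w b.2 v ^ γ)).trans_le h2
  · intro B h0 hstep hlim X hX hbad
    obtain ⟨q, p, r, h₁⟩ := exists_isFirstApprox_of_notMem_badPair hbad hc0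
    obtain ⟨h, j, hjh, hclose⟩ := hL X q p r h₁
    set ρ : ℝ := η * 2 ^ ((j : ℝ) / (4 * m)) / 2 ^ h with hρ
    have hρ0 : 0 < ρ := by positivity
    have hm' : (1 : ℝ) ≤ m := by exact_mod_cast hm
    have hρη : ρ ≤ η := by
      rw [hρ, div_le_iff₀ (by positivity)]
      gcongr
      rw [← Real.rpow_natCast]
      refine Real.rpow_le_rpow_of_exponent_le (by norm_num) ?_
      refine (div_le_self (Nat.cast_nonneg j) (by linarith)).trans ?_
      exact_mod_cast hjh
    have hex : ∃ n, (B n).2 ≤ ρ := ((hlim.eventually_le_const hρ0).exists)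
    have hn := Nat.find_spec hex
    have hmin : ∀ k < Nat.find hex, ¬ (B k).2 ≤ ρ := fun k hk => Nat.find_min hex hk
    set n := Nat.find hex
    have hwin : ρ ≤ (B n).2 / β := by
      rw [le_div_iff₀ hβ]
      rcases Nat.eq_zero_or_pos n with hn0 | hn0
      · rw [hn0]
        calc ρ * β ≤ ρ * 1 := by gcongr
          _ ≤ (B 0).2 := by linarith
      · have h2 := hmin (n - 1) (by omega)
        have h3 := hstep (n - 1)
        rw [Nat.sub_add_cancel hn0] at h3
        nlinarith
    have hw : w (B n).2 (j, h) = 2 * c / 2 ^ h := if_pos hwin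
    refine ⟨n, Nat.pair j h, ?_⟩
    dsimp only
    rw [Nat.unpair_pair, hw]
    exact ⟨by positivity, hclose (B n) (hX n) hn⟩

/-- **Bad(s,t) is hyperplane potential winning**: for all `s, t > 0` with `s + t = 1` and all
`β, c > 0`, Alice has a winning strategy for the `(β,c)`-hyperplane potential game on ℝ² with
target set `Bad(s,t)`. -/
theorem badPair_hyperplane_potential_winning (s t : ℝ) (hs : 0 < s) (ht : 0 < t)
    (hst : s + t = 1) (β c : ℝ) (hβ : 0 < β) (hc : 0 < c) :
    IsHPWWin β c (badPair s t) := by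
  rcases le_or_gt β 1 with hβ1 | hβ1
  · have hη : ∀ r : ℝ, ∃ η : ℝ, 0 < η ∧ η ≤ 1 / 256 ∧ (0 < r → η ≤ r) := by
      intro r
      by_cases hr : 0 < r
      · exact ⟨min (1 / 256) r, lt_min (by norm_num) hr, min_le_left _ _, fun _ => min_le_right _ _⟩
      · exact ⟨1 / 256, by norm_num, le_rfl, fun h => absurd h hr⟩
    choose η hη0 hη1 hηr using hη
    choose τ hτ hwin using fun r => exists_positional_strategy hs ht hst hβ hβ1 hc (hη0 r) (hη1 r)
    refine ⟨fun n h => τ (h 0).2 (h (Fin.last n)), fun n h hpos => hτ _ _ hpos, ?_⟩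
    intro B h0 hstep
    by_cases hlim : Tendsto (fun n => (B n).2) atTop (nhds 0)
    · refine Or.inr fun X hX => ?_
      by_cases hbad : X ∈ badPair s t
      · exact Or.inl hbad
      · exact Or.inr (hwin _ B (hηr _ h0) (fun n => (hstep n).1) hlim X hX hbad)
    · exact Or.inl hlim
  · refine ⟨fun _ _ _ => (⊤, 0), fun n h hpos => ⟨fun i => ⟨le_rfl, fun h => absurd h (lt_irrefl _)⟩,
      ?_, ?_⟩, ?_⟩
    · simp [Real.zero_rpow hc.ne']
    · simp only [Real.zero_rpow hc.ne', tsum_zero]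
      positivity
    · intro B h0 hstep
      refine Or.inl fun hlim => ?_
      have hge : ∀ n, (B 0).2 ≤ (B n).2 := by
        intro n
        induction n with
        | zero => exact le_rfl
        | succ k ih => nlinarith [(hstep k).1]
      exact absurd (ge_of_tendsto' hlim hge) (not_le.2 h0)
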